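/- Let A be a set, n ≥ 1, and let p, q₁, …, qₙ : A³ → A be operations satisfying the Gumm identities on A: (G1) p(x,z,z) = x; (G2) p(x,x,z) = q₁(x,x,z); (G3) qᵢ(x,y,x) = x for all 1 ≤ i ≤ n; (G4) qᵢ(x,x,z) = qᵢ₊₁(x,x,z) for all even i < n; (G5) qᵢ(x,z,z) = qᵢ₊₁(x,z,z) for all odd i < n; (G6) qₙ(x,y,z) = z, for all x, y, z ∈ A. Then there exist N ∈ ℕ and operations m₀, …, m_N : A⁴ → A satisfying the Day identities on A: (D1) m₀(x,y,z,u) = x; (D2) mᵢ(x,y,y,x) = x for all 0 ≤ i ≤ N; (D3) mᵢ(x,x,z,z) = mᵢ₊₁(x,x,z,z) for all even i < N; (D4) mᵢ(x,y,y,u) = mᵢ₊₁(x,y,y,u) for all odd i < N; (D5) m_N(x,y,z,u) = u, for all x, y, z, u ∈ A. Moreover each m_i can be chosen to be a composite of p, the qⱼ, and projections. -/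

import Mathlib

/-- The quaternary operations on `A` that are composites of the ternary operation `p`,
the ternary operations `q j` for `1 ≤ j ≤ n`, and the four projections. -/
inductive IsGummDayComposite {A : Type*} (n : ℕ) (p : A → A → A → A)
    (q : ℕ → A → A → A → A) : (A → A → A → A → A) → Prop
  | proj₁ : IsGummDayComposite n p q fun x _ _ _ => x
  | proj₂ : IsGummDayComposite n p q fun _ y _ _ => y
  | proj₃ : IsGummDayComposite n p q fun _ _ z _ => z
  | proj₄ : IsGummDayComposite n p q fun _ _ _ u => u
  | comp_p (f g h : A → A → A → A → A) :
      IsGummDayComposite n p q f → IsGummDayComposite n p q g →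
      IsGummDayComposite n p q h →
      IsGummDayComposite n p q fun x y z u => p (f x y z u) (g x y z u) (h x y z u)
  | comp_q (j : ℕ) (hj₁ : 1 ≤ j) (hj₂ : j ≤ n) (f g h : A → A → A → A → A) :
      IsGummDayComposite n p q f → IsGummDayComposite n p q g →
      IsGummDayComposite n p q h →
      IsGummDayComposite n p q fun x y z u => q j (f x y z u) (g x y z u) (h x y z u)

/-- The sequence of Day operations built from Gumm operations:
`x, x, p x y z, q 1 x y u, q 1 x z u, q 2 x z u, q 2 x y u, q 3 x y u, …`. -/
def gummDay {A : Type*} (p : A → A → A → A) (q : ℕ → A → A → A → A) :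
    ℕ → A → A → A → A → A
  | 0, x, _, _, _ => x
  | 1, x, _, _, _ => x
  | 2, x, y, z, _ => p x y z
  | k + 3, x, y, z, u => q (k / 2 + 1) x (if k % 4 = 0 ∨ k % 4 = 3 then y else z) u

theorem isGummDayComposite_gummDay {A : Type*} {n : ℕ} (p : A → A → A → A)
    (q : ℕ → A → A → A → A) :
    ∀ i ≤ 2 * n + 1, IsGummDayComposite n p q (gummDay p q i)
  | 0, _ => .proj₁
  | 1, _ => .proj₁
  | 2, _ => .comp_p _ _ _ .proj₁ .proj₂ .proj₃
  | k + 3, hi => by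
    refine .comp_q (k / 2 + 1) (by omega) (by omega) _
      (fun _ y z _ => if k % 4 = 0 ∨ k % 4 = 3 then y else z) _ .proj₁ ?_ .proj₄
    split_ifs
    · exact .proj₂
    · exact .proj₃

/-- If operations `p, q 1, …, q n` (with `n ≥ 1`) satisfy the Gumm identities (G1)–(G6)
on a set `A`, then there are `N` and operations `m 0, …, m N` on `A` satisfying the Day
identities (D1)–(D5), each of which is a composite of `p`, the `q j`, and projections. -/
theorem gumm_terms_give_day_terms {A : Type*} (n : ℕ) (hn : 1 ≤ n)
    (p : A → A → A → A) (q : ℕ → A → A → A → A)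
    (hG1 : ∀ x z : A, p x z z = x)
    (hG2 : ∀ x z : A, p x x z = q 1 x x z)
    (hG3 : ∀ i, 1 ≤ i → i ≤ n → ∀ x y : A, q i x y x = x)
    (hG4 : ∀ i, 1 ≤ i → i < n → Even i → ∀ x z : A, q i x x z = q (i + 1) x x z)
    (hG5 : ∀ i, 1 ≤ i → i < n → Odd i → ∀ x z : A, q i x z z = q (i + 1) x z z)
    (hG6 : ∀ x y z : A, q n x y z = z) :
    ∃ (N : ℕ) (m : ℕ → A → A → A → A → A),
      (∀ x y z u : A, m 0 x y z u = x) ∧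
      (∀ i ≤ N, ∀ x y : A, m i x y y x = x) ∧
      (∀ i < N, Even i → ∀ x z : A, m i x x z z = m (i + 1) x x z z) ∧
      (∀ i < N, Odd i → ∀ x y u : A, m i x y y u = m (i + 1) x y y u) ∧
      (∀ x y z u : A, m N x y z u = u) ∧
      (∀ i ≤ N, IsGummDayComposite n p q (m i)) := by
  refine ⟨2 * n + 1, gummDay p q, fun _ _ _ _ => rfl, ?_, ?_, ?_, ?_,
    isGummDayComposite_gummDay p q⟩
  · rintro (_ | _ | _ | k) hi x y
    · rfl
    · rfl
    · exact hG1 x y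
    · simpa only [gummDay, ite_self] using hG3 (k / 2 + 1) (by omega) (by omega) x y
  · rintro (_ | _ | _ | k) hi he x z
    · rfl
    · exact absurd he (by decide)
    · exact hG2 x z
    · have hk : k % 4 = 1 ∨ k % 4 = 3 := by
        rw [Nat.even_iff] at he
        omega
      have hs : (k + 1) / 2 + 1 = k / 2 + 1 + 1 := by omega
      simp only [gummDay, hs]
      rcases hk with hk | hk
      · rw [if_neg (by omega), if_neg (by omega)]
        exact hG5 _ (by omega) (by omega) (by rw [Nat.odd_iff]; omega) x z
      · rw [if_pos (by omega), if_pos (by omega)]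
        exact hG4 _ (by omega) (by omega) (by rw [Nat.even_iff]; omega) x z
  · rintro (_ | _ | _ | k) hi ho x y u
    · exact absurd ho (by decide)
    · exact (hG1 x y).symm
    · exact absurd ho (by decide)
    · have hs : (k + 1) / 2 = k / 2 := by
        rw [Nat.odd_iff] at ho
        omega
      simp only [gummDay, hs, ite_self]
  · intro x y z u
    obtain ⟨n, rfl⟩ := Nat.exists_eq_add_of_le' hn
    have hs : 2 * n / 2 + 1 = n + 1 := by omega
    change q (2 * n / 2 + 1) x _ u = u
    rw [hs]
    exact hG6 _ _ _
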